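/- arXiv:2202.06805 — 15 statements merged into one kernel-verified Lean document; each statement's English description precedes it below -/
import Mathlib

section
/- Let V be a commutative unital quantale and (X,a) a V-category. The presheaf monad is lax idempotent: the multiplication 𝓂_X is left adjoint to the Yoneda functor 𝓎_{PX}. Concretely: (1) for every presheaf Γ on the V-category PX, the map 𝓂_X(Γ) : x ↦ ⨆_{φ∈PX} φ(x) ⊗ Γ(φ) is a presheaf on X; (2) for every presheaf Γ on PX and every presheaf ψ on X, ⨅_{x∈X} hom(⨆_{φ∈PX} φ(x) ⊗ Γ(φ), ψ(x)) = ⨅_{φ∈PX} hom(Γ(φ), ⨅_{x∈X} hom(φ(x), ψ(x))). -/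
/-- The V-category of presheaves on (X,a): maps φ : X → V with
a(x,x') ⊗ φ(x') ≤ φ(x). -/
def VPresheaf {V : Type*} (tens : V → V → V) [LE V]
    {X : Type*} (a : X → X → V) : Type _ :=
  {φ : X → V // ∀ x x', tens (a x x') (φ x') ≤ φ x}

/-- The presheaf monad is lax idempotent: 𝓂_X ⊣ 𝓎_{PX}.
(1) 𝓂_X(Γ) is a presheaf on X for every presheaf Γ on PX;
(2) ã(𝓂_X(Γ), ψ) = ã(Γ, 𝓎_{PX}(ψ)) for presheaves ψ on X. -/
theorem presheaf_monad_lax_idempotent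
    {V : Type*} [CompleteLattice V]
    (tens : V → V → V) (k : V) (ehom : V → V → V)
    (tens_comm : ∀ u v, tens u v = tens v u)
    (tens_assoc : ∀ u v w, tens (tens u v) w = tens u (tens v w))
    (tens_unit : ∀ u, tens u k = u)
    (k_ne_bot : k ≠ ⊥)
    (tens_sSup : ∀ (u : V) (S : Set V), tens u (sSup S) = ⨆ s ∈ S, tens u s)
    (tens_adj : ∀ u v w, tens u v ≤ w ↔ v ≤ ehom u w)
    {X : Type*} (a : X → X → V)
    (ha_refl : ∀ x, k ≤ a x x)
    (ha_trans : ∀ x y z, tens (a x y) (a y z) ≤ a x z)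
    (Γ : VPresheaf tens a → V)
    (hΓ : ∀ φ φ' : VPresheaf tens a,
      tens (⨅ x, ehom (φ.1 x) (φ'.1 x)) (Γ φ') ≤ Γ φ) :
    (∀ x x', tens (a x x') (⨆ φ : VPresheaf tens a, tens (φ.1 x') (Γ φ)) ≤
      ⨆ φ : VPresheaf tens a, tens (φ.1 x) (Γ φ)) ∧
    (∀ ψ : X → V, (∀ x x', tens (a x x') (ψ x') ≤ ψ x) →
      (⨅ x, ehom (⨆ φ : VPresheaf tens a, tens (φ.1 x) (Γ φ)) (ψ x)) =
        ⨅ φ : VPresheaf tens a, ehom (Γ φ) (⨅ x, ehom (φ.1 x) (ψ x))) := by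
  have gc (u : V) : GaloisConnection (tens u) (ehom u) := fun v w => tens_adj u v w
  refine ⟨fun x x' => ?_, fun ψ _ => eq_of_forall_le_iff fun c => ?_⟩
  · rw [(gc _).l_iSup]
    refine iSup_mono fun φ => ?_
    rw [← tens_assoc, tens_comm _ (Γ φ), tens_comm _ (Γ φ)]
    exact (gc (Γ φ)).monotone_l (φ.2 x x')
  · simp only [le_iInf_iff, ← tens_adj, tens_comm _ c, (gc c).l_iSup, iSup_le_iff]
    rw [forall_comm]
    simp only [tens_comm c, tens_assoc]
end

section
/- The presheaf functor preserves BC*-squares. Let V be a commutative unital quantale, let (W,d), (X,a), (Y,b), (Z,c) be V-categories, and let l : W → Z, g : W → X, f : X → Y, h : Z → Y be V-functors with f∘g = h∘l, forming a BC*-square: b(f x, h z) ≤ ⨆_{w∈W} a(x, g w) ⊗ c(l w, z) for all x ∈ X, z ∈ Z. Then for all presheaves φ on X and ψ on Z: ⨅_{y∈Y} hom(⨆_{x∈X} b(y, f x) ⊗ φ(x), ⨆_{z∈Z} b(y, h z) ⊗ ψ(z)) ≤ ⨆_{γ} [ (⨅_{x∈X} hom(φ(x), ⨆_{w∈W} a(x,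 g w) ⊗ γ(w))) ⊗ (⨅_{z∈Z} hom(⨆_{w∈W} c(z, l w) ⊗ γ(w), ψ(z))) ], where the join on the right runs over all presheaves γ on W. -/
/-- The presheaf functor preserves BC*-squares. -/
theorem presheaf_functor_preserves_BCstar
    {V : Type*} [CompleteLattice V]
    (tens : V → V → V) (k : V) (ehom : V → V → V)
    (tens_comm : ∀ u v, tens u v = tens v u)
    (tens_assoc : ∀ u v w, tens (tens u v) w = tens u (tens v w))
    (tens_unit : ∀ u, tens u k = u)
    (k_ne_bot : k ≠ ⊥)
    (tens_sSup : ∀ (u : V) (S : Set V), tens u (sSup S) = ⨆ s ∈ S, tens u s)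
    (tens_adj : ∀ u v w, tens u v ≤ w ↔ v ≤ ehom u w)
    {W X Y Z : Type*}
    (d : W → W → V) (a : X → X → V) (b : Y → Y → V) (c : Z → Z → V)
    (hd_refl : ∀ w, k ≤ d w w)
    (hd_trans : ∀ u v w, tens (d u v) (d v w) ≤ d u w)
    (ha_refl : ∀ x, k ≤ a x x)
    (ha_trans : ∀ x y z, tens (a x y) (a y z) ≤ a x z)
    (hb_refl : ∀ y, k ≤ b y y)
    (hb_trans : ∀ x y z, tens (b x y) (b y z) ≤ b x z)
    (hc_refl : ∀ z, k ≤ c z z)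
    (hc_trans : ∀ x y z, tens (c x y) (c y z) ≤ c x z)
    (l : W → Z) (g : W → X) (f : X → Y) (h : Z → Y)
    (hl : ∀ w w', d w w' ≤ c (l w) (l w'))
    (hg : ∀ w w', d w w' ≤ a (g w) (g w'))
    (hf : ∀ x x', a x x' ≤ b (f x) (f x'))
    (hh : ∀ z z', c z z' ≤ b (h z) (h z'))
    (hcomm : ∀ w, f (g w) = h (l w))
    (hBC : ∀ x z, b (f x) (h z) ≤ ⨆ w, tens (a x (g w)) (c (l w) z))
    (φ : X → V) (hφ : ∀ x x', tens (a x x') (φ x') ≤ φ x)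
    (ψ : Z → V) (hψ : ∀ z z', tens (c z z') (ψ z') ≤ ψ z) :
    (⨅ y, ehom (⨆ x, tens (b y (f x)) (φ x)) (⨆ z, tens (b y (h z)) (ψ z))) ≤
      ⨆ γ : VPresheaf tens d,
        tens (⨅ x, ehom (φ x) (⨆ w, tens (a x (g w)) (γ.1 w)))
             (⨅ z, ehom (⨆ w, tens (c z (l w)) (γ.1 w)) (ψ z)) := by
  have mono_right : ∀ u {v v' : V}, v ≤ v' → tens u v ≤ tens u v' := fun u _ _ hv =>
    (tens_adj _ _ _).2 (hv.trans ((tens_adj _ _ _).1 le_rfl))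
  have mono_left : ∀ u {v v' : V}, v ≤ v' → tens v u ≤ tens v' u := fun u v v' hv => by
    rw [tens_comm v, tens_comm v']
    exact mono_right u hv
  -- The presheaf `ψ ∘ l` makes the second factor at least `k`.
  refine le_trans ?_ (le_iSup _ (⟨fun w => ψ (l w), fun w w' =>
    (mono_left _ (hl w w')).trans (hψ _ _)⟩ : VPresheaf tens d))
  rw [← tens_unit (⨅ y, _)]
  refine (mono_left _ (le_iInf fun x => ?_)).trans (mono_right _ (le_iInf fun z => ?_))
  · refine (iInf_le _ (f x)).trans ((tens_adj _ _ _).1 ?_)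
    have hφx : φ x ≤ ⨆ x', tens (b (f x) (f x')) (φ x') := by
      refine le_trans ?_ (le_iSup _ x)
      calc φ x = tens k (φ x) := by rw [tens_comm, tens_unit]
        _ ≤ _ := mono_left _ (hb_refl _)
    refine (mono_left _ hφx).trans (((tens_adj _ _ _).2 le_rfl).trans (iSup_le fun z => ?_))
    refine (mono_left _ (hBC x z)).trans ?_
    rw [tens_comm, tens_adj]
    refine iSup_le fun w => ?_
    rw [← tens_adj, tens_comm, tens_assoc]
    exact (mono_right _ (hψ _ _)).trans (le_iSup (fun w => tens (a x (g w)) (ψ (l w))) w)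
  · rw [← tens_adj, tens_unit]
    exact iSup_le fun w => hψ _ _
end

section
/- P-embeddings are exactly the fully faithful V-functors. Let V be a commutative unital quantale and h : (X,a) → (Y,b) a V-functor. The following are equivalent: (i) h is fully faithful, i.e. b(h x, h x') = a(x,x') for all x,x' ∈ X; (ii) Q h ∘ P h is the identity on presheaves, i.e. for every presheaf φ on X and every x ∈ X, ⨆_{x'∈X} b(h x, h x') ⊗ φ(x') = φ(x). -/
/-- P-embeddings are exactly the fully faithful V-functors:
h is fully faithful iff Qh ∘ Ph is the identity on presheaves. -/
theorem P_embedding_iff_fully_faithful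
    {V : Type*} [CompleteLattice V]
    (tens : V → V → V) (k : V) (ehom : V → V → V)
    (tens_comm : ∀ u v, tens u v = tens v u)
    (tens_assoc : ∀ u v w, tens (tens u v) w = tens u (tens v w))
    (tens_unit : ∀ u, tens u k = u)
    (k_ne_bot : k ≠ ⊥)
    (tens_sSup : ∀ (u : V) (S : Set V), tens u (sSup S) = ⨆ s ∈ S, tens u s)
    (tens_adj : ∀ u v w, tens u v ≤ w ↔ v ≤ ehom u w)
    {X Y : Type*} (a : X → X → V) (b : Y → Y → V)
    (ha_refl : ∀ x, k ≤ a x x)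
    (ha_trans : ∀ x y z, tens (a x y) (a y z) ≤ a x z)
    (hb_refl : ∀ y, k ≤ b y y)
    (hb_trans : ∀ x y z, tens (b x y) (b y z) ≤ b x z)
    (h : X → Y) (hh : ∀ x x', a x x' ≤ b (h x) (h x')) :
    (∀ x x', b (h x) (h x') = a x x')
    ↔
    (∀ φ : X → V, (∀ x x', tens (a x x') (φ x') ≤ φ x) →
      ∀ x, (⨆ x', tens (b (h x) (h x')) (φ x')) = φ x) := by
  have tens_mono : ∀ u v w, v ≤ w → tens u v ≤ tens u w := fun u v w hvw =>
    (tens_adj u v _).2 (hvw.trans ((tens_adj u w _).1 le_rfl))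
  have le_tens : ∀ u v, k ≤ v → u ≤ tens u v := fun u v hv =>
    (tens_unit u).symm.le.trans (tens_mono u k v hv)
  constructor
  · intro hff φ hφ x
    simp only [hff]
    refine le_antisymm (iSup_le fun x' => hφ x x') ?_
    refine le_iSup_of_le x ?_
    rw [tens_comm]
    exact le_tens _ _ (ha_refl x)
  · intro hP x y
    refine le_antisymm ?_ (hh x y)
    rw [← hP (fun z => a z y) (fun z z' => ha_trans z z' y) x]
    exact le_iSup_of_le y (le_tens _ _ (ha_refl y))
end

section
/- Let V be a commutative unital quantale, (X,a), (Y,b), (Z,c) V-categories, φ a V-distributor from (X,a) to (Y,b), and f : (X,a) → (Z,c) a V-functor. The following are equivalent: (i) the φ-weighted colimit of f exists, i.e. there is a map g : Y → Z with c(g y, z) = ⨅_{x∈X} hom(φ(x,y), c(f x, z)) for all y ∈ Y, z ∈ Z; (ii) the (φ·f^*)-weighted colimit of the identity of Z exists, i.e. there is a map g' : Y → Z with c(g' y, z') = ⨅_{z∈Z} hom(⨆_{x∈X} c(z, f x) ⊗ φ(x,y), c(z, z')) for all y ∈ Y, z' ∈ Z; (iii) for every y ∈ Y there exists z_y ∈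 Z with c(z_y, z) = ⨅_{x∈X} hom(φ(x,y), c(f x, z)) for all z ∈ Z. Moreover, any map g as in (i) is automatically a V-functor. -/
/-- Existence of the φ-weighted colimit of f is equivalent to
existence of the (φ·f^*)-colimit of 1_Z and to the pointwise existence of
(y^*·φ)-colimits; moreover any representing map g is automatically a
V-functor. -/
theorem weighted_colimit_existence
    {V : Type*} [CompleteLattice V]
    (tens : V → V → V) (k : V) (ehom : V → V → V)
    (tens_comm : ∀ u v, tens u v = tens v u)
    (tens_assoc : ∀ u v w, tens (tens u v) w = tens u (tens v w))
    (tens_unit : ∀ u, tens u k = u)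
    (k_ne_bot : k ≠ ⊥)
    (tens_sSup : ∀ (u : V) (S : Set V), tens u (sSup S) = ⨆ s ∈ S, tens u s)
    (tens_adj : ∀ u v w, tens u v ≤ w ↔ v ≤ ehom u w)
    {X Y Z : Type*} (a : X → X → V) (b : Y → Y → V) (c : Z → Z → V)
    (ha_refl : ∀ x, k ≤ a x x)
    (ha_trans : ∀ x y z, tens (a x y) (a y z) ≤ a x z)
    (hb_refl : ∀ y, k ≤ b y y)
    (hb_trans : ∀ x y z, tens (b x y) (b y z) ≤ b x z)
    (hc_refl : ∀ z, k ≤ c z z)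
    (hc_trans : ∀ x y z, tens (c x y) (c y z) ≤ c x z)
    (φ : X → Y → V)
    (hφ₁ : ∀ x x' y, tens (a x x') (φ x' y) ≤ φ x y)
    (hφ₂ : ∀ x y' y, tens (φ x y') (b y' y) ≤ φ x y)
    (f : X → Z) (hf : ∀ x x', a x x' ≤ c (f x) (f x')) :
    ((∃ g : Y → Z, ∀ y z, c (g y) z = ⨅ x, ehom (φ x y) (c (f x) z)) ↔
     (∃ g' : Y → Z, ∀ y z', c (g' y) z' =
        ⨅ z, ehom (⨆ x, tens (c z (f x)) (φ x y)) (c z z'))) ∧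
    ((∃ g : Y → Z, ∀ y z, c (g y) z = ⨅ x, ehom (φ x y) (c (f x) z)) ↔
     (∀ y, ∃ zy : Z, ∀ z, c zy z = ⨅ x, ehom (φ x y) (c (f x) z))) ∧
    (∀ g : Y → Z, (∀ y z, c (g y) z = ⨅ x, ehom (φ x y) (c (f x) z)) →
      ∀ y y', b y y' ≤ c (g y) (g y')) := by
  have tens_mono : ∀ {u v v' : V}, v ≤ v' → tens u v ≤ tens u v' := fun {u v v'} h =>
    (tens_adj _ _ _).2 (h.trans ((tens_adj _ _ _).1 le_rfl))
  have key : ∀ y z', (⨅ x, ehom (φ x y) (c (f x) z')) =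
      ⨅ z, ehom (⨆ x, tens (c z (f x)) (φ x y)) (c z z') := by
    intro y z'
    refine eq_of_forall_le_iff fun u => ?_
    simp only [le_iInf_iff, ← tens_adj]
    constructor
    · intro h z
      rw [tens_comm, tens_adj]
      refine iSup_le fun x => ?_
      rw [← tens_adj, tens_comm, tens_assoc]
      exact (tens_mono (h x)).trans (hc_trans _ _ _)
    · intro h x
      have hx := h (f x)
      rw [tens_comm, tens_adj] at hx
      have hx' := (le_iSup (fun x' => tens (c (f x) (f x')) (φ x' y)) x).trans hx
      rw [← tens_adj, tens_comm, tens_assoc, tens_comm] at hx'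
      refine le_trans ?_ hx'
      calc tens (φ x y) u = tens (tens (φ x y) u) k := (tens_unit _).symm
        _ ≤ _ := tens_mono (hc_refl _)
  refine ⟨by simp only [key], ⟨fun ⟨g, hg⟩ y => ⟨g y, hg y⟩, fun h => ?_⟩, ?_⟩
  · choose g hg using h
    exact ⟨g, hg⟩
  · intro g hg y y'
    rw [hg]
    refine le_iInf fun x => (tens_adj _ _ _).1 ((hφ₂ x y y').trans ?_)
    have h := ((hc_refl (g y')).trans_eq (hg y' (g y'))).trans (iInf_le _ x)
    rwa [← tens_adj, tens_unit] at h
end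

section
/- The canonical comparison from the extended formal ball construction to the presheaf construction is fully faithful: for every commutative unital quantale V, every V-category (X,a), and all x,y ∈ X and r,s ∈ V, one has hom(r, a(x,y) ⊗ s) = ⨅_{z∈X} hom(a(z,x) ⊗ r, a(z,y) ⊗ s). (That is, the map σ_X : B̄X → PX sending (x,r) to the presheaf z ↦ a(z,x) ⊗ r satisfies ã(σ_X(x,r), σ_X(y,s)) = B̄X((x,r),(y,s)).) -/
/-- The canonical comparison σ_X : B̄X → PX, (x,r) ↦ a(−,x) ⊗ r,
is fully faithful: ã(σ_X(x,r), σ_X(y,s)) = B̄X((x,r),(y,s)). -/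
theorem ball_to_presheaf_fully_faithful
    {V : Type*} [CompleteLattice V]
    (tens : V → V → V) (k : V) (ehom : V → V → V)
    (tens_comm : ∀ u v, tens u v = tens v u)
    (tens_assoc : ∀ u v w, tens (tens u v) w = tens u (tens v w))
    (tens_unit : ∀ u, tens u k = u)
    (k_ne_bot : k ≠ ⊥)
    (tens_sSup : ∀ (u : V) (S : Set V), tens u (sSup S) = ⨆ s ∈ S, tens u s)
    (tens_adj : ∀ u v w, tens u v ≤ w ↔ v ≤ ehom u w)
    {X : Type*} (a : X → X → V)
    (ha_refl : ∀ x, k ≤ a x x)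
    (ha_trans : ∀ x y z, tens (a x y) (a y z) ≤ a x z) :
    ∀ (x y : X) (r s : V),
      ehom r (tens (a x y) s) = ⨅ z, ehom (tens (a z x) r) (tens (a z y) s) := by
  intro x y r s
  have mono_right : ∀ {u v w : V}, v ≤ w → tens u v ≤ tens u w := fun {u v w} h =>
    (tens_adj u v _).2 (h.trans ((tens_adj u w _).1 le_rfl))
  have mono_left : ∀ {u v w : V}, u ≤ v → tens u w ≤ tens v w := fun {u v w} h => by
    rw [tens_comm u, tens_comm v]
    exact mono_right h
  apply le_antisymm
  · refine le_iInf fun z => (tens_adj _ _ _).1 ?_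
    calc tens (tens (a z x) r) (ehom r (tens (a x y) s))
        = tens (a z x) (tens r (ehom r (tens (a x y) s))) := tens_assoc _ _ _
      _ ≤ tens (a z x) (tens (a x y) s) := mono_right ((tens_adj _ _ _).2 le_rfl)
      _ = tens (tens (a z x) (a x y)) s := (tens_assoc _ _ _).symm
      _ ≤ tens (a z y) s := mono_left (ha_trans z x y)
  · have le_tens_self : r ≤ tens (a x x) r :=
      calc r = tens k r := by rw [tens_comm, tens_unit]
        _ ≤ tens (a x x) r := mono_left (ha_refl x)
    exact (tens_adj _ _ _).1
      ((mono_left le_tens_self).trans ((tens_adj _ _ _).2 (iInf_le _ x)))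
end

section
/- A V-category is a B̄-algebra if and only if it is tensored. Let V be a commutative unital quantale and (X,a) a V-category. The following are equivalent: (i) there exists a map α : X × V → X such that α is a V-functor from B̄X to (X,a) (i.e. hom(r, a(x,y) ⊗ s) ≤ a(α(x,r), α(y,s)) for all x,y ∈ X and r,s ∈ V) and α(x,k) = x for all x ∈ X; (ii) (X,a) is tensored: for every x ∈ X and r ∈ V there exists z ∈ X such that a(z,y) = hom(r, a(x,y)) for all y ∈ X. -/
/-- A V-category is a B̄-algebra iff it is tensored. -/
theorem ball_algebra_iff_tensored
    {V : Type*} [CompleteLattice V]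
    (tens : V → V → V) (k : V) (ehom : V → V → V)
    (tens_comm : ∀ u v, tens u v = tens v u)
    (tens_assoc : ∀ u v w, tens (tens u v) w = tens u (tens v w))
    (tens_unit : ∀ u, tens u k = u)
    (k_ne_bot : k ≠ ⊥)
    (tens_sSup : ∀ (u : V) (S : Set V), tens u (sSup S) = ⨆ s ∈ S, tens u s)
    (tens_adj : ∀ u v w, tens u v ≤ w ↔ v ≤ ehom u w)
    {X : Type*} (a : X → X → V)
    (ha_refl : ∀ x, k ≤ a x x)
    (ha_trans : ∀ x y z, tens (a x y) (a y z) ≤ a x z) :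
    (∃ α : X → V → X,
      (∀ (x y : X) (r s : V),
        ehom r (tens (a x y) s) ≤ a (α x r) (α y s)) ∧
      (∀ x, α x k = x))
    ↔
    (∀ (x : X) (r : V), ∃ z : X, ∀ y : X, a z y = ehom r (a x y)) := by
  classical
  have mono_right : ∀ w u v, u ≤ v → tens w u ≤ tens w v := fun w u v h =>
    (tens_adj _ _ _).2 (h.trans ((tens_adj _ _ _).1 le_rfl))
  have mono_left : ∀ w u v, u ≤ v → tens u w ≤ tens v w := fun w u v h => by
    rw [tens_comm u, tens_comm v]
    exact mono_right w u v h
  have unit_tens : ∀ u, tens k u = u := fun u => by rw [tens_comm, tens_unit]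
  have tens_ehom_le : ∀ u w, tens u (ehom u w) ≤ w := fun u w => (tens_adj _ _ _).2 le_rfl
  have ehom_mono : ∀ u v w, v ≤ w → ehom u v ≤ ehom u w := fun u v w h =>
    (tens_adj _ _ _).1 ((tens_ehom_le u v).trans h)
  have ehom_unit : ∀ u, ehom k u = u := fun u => by
    apply le_antisymm
    · simpa only [unit_tens] using tens_ehom_le k u
    · exact (tens_adj _ _ _).1 (unit_tens u).le
  constructor
  · rintro ⟨α, hα, hα_unit⟩ x r
    refine ⟨α x r, fun y => le_antisymm ?_ ?_⟩
    · have le_unit : r ≤ a x (α x r) := by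
        have h := hα x x k r
        rw [ehom_unit, hα_unit] at h
        refine le_trans ?_ h
        simpa only [unit_tens] using mono_left r _ _ (ha_refl x)
      exact (tens_adj _ _ _).1 ((mono_left _ _ _ le_unit).trans (ha_trans _ _ _))
    · simpa only [tens_unit, hα_unit] using hα x y r k
  · intro tensored
    choose t ht using tensored
    have exists_action : ∃ α : X → V → X,
        (∀ x r y, a (α x r) y = ehom r (a x y)) ∧ ∀ x, α x k = x := by
      refine ⟨fun x r => if r = k then x else t x r, fun x r y => ?_, fun x => if_pos rfl⟩
      dsimp only
      split_ifs with h
      · rw [h, ehom_unit]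
      · exact ht x r y
    obtain ⟨α, hα, hα_unit⟩ := exists_action
    refine ⟨α, fun x y r s => ?_, hα_unit⟩
    rw [hα]
    refine ehom_mono _ _ _ ((mono_right _ _ _ ?_).trans (ha_trans x y (α y s)))
    have h := ha_refl (α y s)
    rw [hα, ← tens_adj, tens_unit] at h
    exact h
end

section
/- Let V be a commutative unital quantale in which r ⊗ s ≠ ⊥ whenever r ≠ ⊥ and s ≠ ⊥, let (X,a) be a separated V-category, and let α : X × V → X satisfy hom(r, a(x,y) ⊗ s) ≤ a(α(x,r), α(y,s)) for all x,y ∈ X and all r,s ∈ V∖{⊥} (i.e. α is a V-functor BX → X). The following are equivalent: (i) α(x,k) = x for all x ∈ X and α(x, r ⊗ s) = α(α(x,r), s) for all x ∈ X and r,s ∈ V∖{⊥}; (ii) α(x,k) = x for all x ∈ X and r ≤ a(x, α(x,r)) for all x ∈ X and r ∈ V∖{⊥}; (iii) α(x,k) = x for all x ∈ X. -/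
/-- For a V-functor α : BX → X on a separated V-category over a
quantale without zero divisors, the B-algebra axioms are equivalent to each
of the listed conditions. -/
theorem ball_algebra_structure_characterisation
    {V : Type*} [CompleteLattice V]
    (tens : V → V → V) (k : V) (ehom : V → V → V)
    (tens_comm : ∀ u v, tens u v = tens v u)
    (tens_assoc : ∀ u v w, tens (tens u v) w = tens u (tens v w))
    (tens_unit : ∀ u, tens u k = u)
    (k_ne_bot : k ≠ ⊥)
    (tens_sSup : ∀ (u : V) (S : Set V), tens u (sSup S) = ⨆ s ∈ S, tens u s)
    (tens_adj : ∀ u v w, tens u v ≤ w ↔ v ≤ ehom u w)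
    (tens_ne_bot : ∀ r s : V, r ≠ ⊥ → s ≠ ⊥ → tens r s ≠ ⊥)
    {X : Type*} (a : X → X → V)
    (ha_refl : ∀ x, k ≤ a x x)
    (ha_trans : ∀ x y z, tens (a x y) (a y z) ≤ a x z)
    (ha_sep : ∀ x y, k ≤ a x y → k ≤ a y x → x = y)
    (α : X → V → X)
    (hα : ∀ (x y : X) (r s : V), r ≠ ⊥ → s ≠ ⊥ →
      ehom r (tens (a x y) s) ≤ a (α x r) (α y s)) :
    (((∀ x, α x k = x) ∧
        ∀ (x : X) (r s : V), r ≠ ⊥ → s ≠ ⊥ → α x (tens r s) = α (α x r) s) ↔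
      ((∀ x, α x k = x) ∧
        ∀ (x : X) (r : V), r ≠ ⊥ → r ≤ a x (α x r))) ∧
    (((∀ x, α x k = x) ∧
        ∀ (x : X) (r : V), r ≠ ⊥ → r ≤ a x (α x r)) ↔
      (∀ x, α x k = x)) := by
  have tens_mono_left : ∀ {u v : V} (w : V), u ≤ v → tens u w ≤ tens v w := by
    intro u v w h
    rw [tens_comm u w, tens_adj]
    exact h.trans ((tens_adj w v _).1 (tens_comm w v).le)
  have le_tens_self : ∀ x r, r ≤ tens (a x x) r := by
    intro x r
    have h := tens_mono_left r (ha_refl x)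
    rwa [tens_comm k r, tens_unit] at h
  have unit_le_ehom : ∀ {u v : V}, u ≤ v → k ≤ ehom u v := by
    intro u v h
    rw [← tens_adj, tens_unit]
    exact h
  have expansive : (∀ x, α x k = x) → ∀ (x : X) (r : V), r ≠ ⊥ → r ≤ a x (α x r) := by
    intro hk x r hr
    have h := hα x x k r k_ne_bot hr
    rw [hk] at h
    refine le_trans ((tens_adj _ _ _).1 ?_) h
    rw [tens_comm, tens_unit]
    exact le_tens_self x r
  have action : (∀ x, α x k = x) → ∀ (x : X) (r s : V), r ≠ ⊥ → s ≠ ⊥ →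
      α x (tens r s) = α (α x r) s := by
    intro hk x r s hr hs
    have hrs := tens_ne_bot r s hr hs
    apply ha_sep
    · exact (unit_le_ehom (tens_mono_left s (expansive hk x r hr))).trans
        (hα x (α x r) (tens r s) s hrs hs)
    · have hle : s ≤ a (α x r) (α x (tens r s)) :=
        ((tens_adj _ _ _).1 (le_tens_self x _)).trans (hα x x r (tens r s) hr hrs)
      have h := hα (α x r) (α x (tens r s)) s k hs k_ne_bot
      rw [hk, tens_unit] at h
      exact (unit_le_ehom hle).trans h
  exact ⟨⟨fun h => ⟨h.1, expansive h.1⟩, fun h => ⟨h.1, action h.1⟩⟩,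
    ⟨fun h => h.1, fun h => ⟨h, expansive h⟩⟩⟩
end

section
/- Let V be a commutative unital quantale and let (X,a), (Y,b) be V-categories equipped with B-algebra structures ⊕. For a map f : X → Y the following are equivalent: (i) f is a V-functor, i.e. a(x,x') ≤ b(f x, f x') for all x,x' ∈ X; (ii) f is monotone (k ≤ a(x,x') implies k ≤ b(f x, f x')) and k ≤ b(f(x) ⊕ r, f(x ⊕ r)) for all x ∈ X and r ∈ V∖{⊥}. -/
/-- For B-algebras (X,⊕), (Y,⊕), a map f : X → Y is a V-functor
iff it is monotone and f(x) ⊕ r ≤ f(x ⊕ r) for all x, r ≠ ⊥. -/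
theorem V_functor_iff_monotone_oplus
    {V : Type*} [CompleteLattice V]
    (tens : V → V → V) (k : V) (ehom : V → V → V)
    (tens_comm : ∀ u v, tens u v = tens v u)
    (tens_assoc : ∀ u v w, tens (tens u v) w = tens u (tens v w))
    (tens_unit : ∀ u, tens u k = u)
    (k_ne_bot : k ≠ ⊥)
    (tens_sSup : ∀ (u : V) (S : Set V), tens u (sSup S) = ⨆ s ∈ S, tens u s)
    (tens_adj : ∀ u v w, tens u v ≤ w ↔ v ≤ ehom u w)
    {X Y : Type*} (a : X → X → V) (b : Y → Y → V)
    (ha_refl : ∀ x, k ≤ a x x)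
    (ha_trans : ∀ x y z, tens (a x y) (a y z) ≤ a x z)
    (hb_refl : ∀ y, k ≤ b y y)
    (hb_trans : ∀ x y z, tens (b x y) (b y z) ≤ b x z)
    (oplusX : X → V → X)
    (hoX : ∀ (x y : X) (r : V), r ≠ ⊥ → a (oplusX x r) y = ehom r (a x y))
    (oplusY : Y → V → Y)
    (hoY : ∀ (x y : Y) (r : V), r ≠ ⊥ → b (oplusY x r) y = ehom r (b x y))
    (f : X → Y) :
    (∀ x x', a x x' ≤ b (f x) (f x'))
    ↔
    ((∀ x x', k ≤ a x x' → k ≤ b (f x) (f x')) ∧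
     (∀ (x : X) (r : V), r ≠ ⊥ → k ≤ b (oplusY (f x) r) (f (oplusX x r)))) := by
  have unit_le_ehom : ∀ u w, k ≤ ehom u w ↔ u ≤ w := fun u w => by
    rw [← tens_adj, tens_unit]
  constructor
  · intro hf
    refine ⟨fun x x' h => h.trans (hf x x'), fun x r hr => ?_⟩
    have hx := ha_refl (oplusX x r)
    rw [hoX _ _ _ hr, unit_le_ehom] at hx
    rw [hoY _ _ _ hr, unit_le_ehom]
    exact hx.trans (hf _ _)
  · rintro ⟨hmono, hop⟩ x x'
    by_cases hr : a x x' = ⊥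
    · exact hr ▸ bot_le
    have hx := hop x _ hr
    rw [hoY _ _ _ hr, unit_le_ehom] at hx
    have hx' : k ≤ b (f (oplusX x (a x x'))) (f x') := by
      apply hmono
      rw [hoX _ _ _ hr, unit_le_ehom]
    exact hx.trans ((unit_le_ehom _ _).1 (hx'.trans ((tens_adj _ _ _).1 (hb_trans _ _ _))))
end

section
/- Let V be a commutative unital quantale and let (X,a), (Y,b) be V-categories equipped with B-algebra structures ⊕. If a map f : X → Y is monotone (k ≤ a(x,x') implies k ≤ b(f x, f x')) and satisfies f(x ⊕ r) = f(x) ⊕ r for all x ∈ X and r ∈ V∖{⊥}, then f is a V-functor; consequently, f is a B-algebra morphism (a V-functor with f(x ⊕ r) = f(x) ⊕ r for all x, r ≠ ⊥) if and only if f is monotone and f(x ⊕ r) = f(x) ⊕ r for all x ∈ X and r ∈ V∖{⊥}. -/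
/-- In a B-algebra, `r ≤ a x y` says exactly that `x ⊕ r ≤ y` in the underlying order. -/
theorem le_iff_unit_le_oplus {V X : Type*} [LE V] {tens ehom : V → V → V} {k r : V}
    (tens_unit : ∀ u, tens u k = u)
    (tens_adj : ∀ u v w, tens u v ≤ w ↔ v ≤ ehom u w)
    {a : X → X → V} {x x' y : X} (h : a x' y = ehom r (a x y)) :
    r ≤ a x y ↔ k ≤ a x' y := by
  rw [h, ← tens_adj, tens_unit]

/-- A monotone map between B-algebras strictly preserving ⊕ is a
V-functor; hence f is a B-algebra morphism iff it is monotone and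
f(x ⊕ r) = f(x) ⊕ r for all x, r ≠ ⊥. -/
theorem B_algebra_morphism_characterisation
    {V : Type*} [CompleteLattice V]
    (tens : V → V → V) (k : V) (ehom : V → V → V)
    (tens_comm : ∀ u v, tens u v = tens v u)
    (tens_assoc : ∀ u v w, tens (tens u v) w = tens u (tens v w))
    (tens_unit : ∀ u, tens u k = u)
    (k_ne_bot : k ≠ ⊥)
    (tens_sSup : ∀ (u : V) (S : Set V), tens u (sSup S) = ⨆ s ∈ S, tens u s)
    (tens_adj : ∀ u v w, tens u v ≤ w ↔ v ≤ ehom u w)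
    {X Y : Type*} (a : X → X → V) (b : Y → Y → V)
    (ha_refl : ∀ x, k ≤ a x x)
    (ha_trans : ∀ x y z, tens (a x y) (a y z) ≤ a x z)
    (hb_refl : ∀ y, k ≤ b y y)
    (hb_trans : ∀ x y z, tens (b x y) (b y z) ≤ b x z)
    (oplusX : X → V → X)
    (hoX : ∀ (x y : X) (r : V), r ≠ ⊥ → a (oplusX x r) y = ehom r (a x y))
    (oplusY : Y → V → Y)
    (hoY : ∀ (x y : Y) (r : V), r ≠ ⊥ → b (oplusY x r) y = ehom r (b x y))
    (f : X → Y) :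
    ((∀ x x', k ≤ a x x' → k ≤ b (f x) (f x')) →
     (∀ (x : X) (r : V), r ≠ ⊥ → f (oplusX x r) = oplusY (f x) r) →
     (∀ x x', a x x' ≤ b (f x) (f x'))) ∧
    (((∀ x x', a x x' ≤ b (f x) (f x')) ∧
      (∀ (x : X) (r : V), r ≠ ⊥ → f (oplusX x r) = oplusY (f x) r))
     ↔
     ((∀ x x', k ≤ a x x' → k ≤ b (f x) (f x')) ∧
      (∀ (x : X) (r : V), r ≠ ⊥ → f (oplusX x r) = oplusY (f x) r))) := by
  have functor_of_monotone (hmono : ∀ x x', k ≤ a x x' → k ≤ b (f x) (f x'))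
      (hf : ∀ (x : X) (r : V), r ≠ ⊥ → f (oplusX x r) = oplusY (f x) r) (x x' : X) :
      a x x' ≤ b (f x) (f x') := by
    by_cases hr : a x x' = ⊥
    · exact hr ▸ bot_le
    · rw [le_iff_unit_le_oplus tens_unit tens_adj (hoY (f x) (f x') _ hr), ← hf x _ hr]
      exact hmono _ _ ((le_iff_unit_le_oplus tens_unit tens_adj (hoX x x' _ hr)).1 le_rfl)
  exact ⟨functor_of_monotone,
    fun h => ⟨fun x x' hx => hx.trans (h.1 x x'), h.2⟩,
    fun h => ⟨functor_of_monotone h.1 h.2, h.2⟩⟩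
end

section
/- Let V be a commutative unital quantale, let (X,a), (Y,b) be V-categories equipped with B-algebra structures ⊕, and let f : X → Y be a V-functor. Then k ≤ b(f(x) ⊕ r, f(x ⊕ r)) for all x ∈ X and r ∈ V∖{⊥}. Moreover, if (Y,b) is separated, then f satisfies f(x ⊕ r) = f(x) ⊕ r for all x ∈ X, r ∈ V∖{⊥} (i.e. f is a B-algebra morphism) if and only if k ≤ b(f(x ⊕ r), f(x) ⊕ r) for all x ∈ X, r ∈ V∖{⊥}. -/
/-- For a V-functor f between B-algebras, f(x) ⊕ r ≤ f(x ⊕ r);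
if Y is separated, f is a B-algebra morphism iff f(x ⊕ r) ≤ f(x) ⊕ r. -/
theorem V_functor_between_B_algebras
    {V : Type*} [CompleteLattice V]
    (tens : V → V → V) (k : V) (ehom : V → V → V)
    (tens_comm : ∀ u v, tens u v = tens v u)
    (tens_assoc : ∀ u v w, tens (tens u v) w = tens u (tens v w))
    (tens_unit : ∀ u, tens u k = u)
    (k_ne_bot : k ≠ ⊥)
    (tens_sSup : ∀ (u : V) (S : Set V), tens u (sSup S) = ⨆ s ∈ S, tens u s)
    (tens_adj : ∀ u v w, tens u v ≤ w ↔ v ≤ ehom u w)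
    {X Y : Type*} (a : X → X → V) (b : Y → Y → V)
    (ha_refl : ∀ x, k ≤ a x x)
    (ha_trans : ∀ x y z, tens (a x y) (a y z) ≤ a x z)
    (hb_refl : ∀ y, k ≤ b y y)
    (hb_trans : ∀ x y z, tens (b x y) (b y z) ≤ b x z)
    (oplusX : X → V → X)
    (hoX : ∀ (x y : X) (r : V), r ≠ ⊥ → a (oplusX x r) y = ehom r (a x y))
    (oplusY : Y → V → Y)
    (hoY : ∀ (x y : Y) (r : V), r ≠ ⊥ → b (oplusY x r) y = ehom r (b x y))
    (f : X → Y) (hf : ∀ x x', a x x' ≤ b (f x) (f x')) :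
    (∀ (x : X) (r : V), r ≠ ⊥ → k ≤ b (oplusY (f x) r) (f (oplusX x r))) ∧
    ((∀ y y' : Y, k ≤ b y y' → k ≤ b y' y → y = y') →
      ((∀ (x : X) (r : V), r ≠ ⊥ → f (oplusX x r) = oplusY (f x) r)
       ↔
       (∀ (x : X) (r : V), r ≠ ⊥ → k ≤ b (f (oplusX x r)) (oplusY (f x) r)))) := by
  have le_iff : ∀ r w, k ≤ ehom r w ↔ r ≤ w := fun r w => by
    rw [← tens_adj, tens_unit]
  have lax : ∀ (x : X) (r : V), r ≠ ⊥ → k ≤ b (oplusY (f x) r) (f (oplusX x r)) := by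
    intro x r hr
    have hx : r ≤ a x (oplusX x r) := by
      rw [← le_iff, ← hoX _ _ _ hr]
      exact ha_refl _
    rw [hoY _ _ _ hr, le_iff]
    exact hx.trans (hf _ _)
  refine ⟨lax, fun hsep => ⟨fun h x r hr => ?_, fun h x r hr => ?_⟩⟩
  · rw [h x r hr]
    exact hb_refl _
  · exact hsep _ _ (h x r hr) (lax x r hr)
end

section
/- Let V be an integral commutative unital quantale. The following are equivalent: (i) BV is separated, i.e. for all x,y ∈ V and r,s ∈ V∖{⊥}, if k ≤ hom(r, hom(x,y) ⊗ s) and k ≤ hom(s, hom(y,x) ⊗ r), then x = y and r = s; (ii) V is cancellative, i.e. for all r,s ∈ V with r ≠ ⊥, r = s ⊗ r implies s = k; (iii) for every separated V-category (X,a), BX is separated: for all x,y ∈ X and r,s ∈ V∖{⊥}, if k ≤ hom(r, a(x,y) ⊗ s) and k ≤ hom(s, a(y,x) ⊗ r), then x = y and r = s. -/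
/-- For an integral quantale V, the following are equivalent:
(i) BV is separated; (ii) V is cancellative; (iii) BX is separated for every
separated V-category X. -/
theorem ball_space_separated_iff_cancellative
    {V : Type*} [CompleteLattice V]
    (tens : V → V → V) (k : V) (ehom : V → V → V)
    (tens_comm : ∀ u v, tens u v = tens v u)
    (tens_assoc : ∀ u v w, tens (tens u v) w = tens u (tens v w))
    (tens_unit : ∀ u, tens u k = u)
    (k_ne_bot : k ≠ ⊥)
    (tens_sSup : ∀ (u : V) (S : Set V), tens u (sSup S) = ⨆ s ∈ S, tens u s)
    (tens_adj : ∀ u v w, tens u v ≤ w ↔ v ≤ ehom u w)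
    (integral : k = (⊤ : V)) :
    ((∀ (x y r s : V), r ≠ ⊥ → s ≠ ⊥ →
        k ≤ ehom r (tens (ehom x y) s) → k ≤ ehom s (tens (ehom y x) r) →
        x = y ∧ r = s)
     ↔
     (∀ r s : V, r ≠ ⊥ → r = tens s r → s = k)) ∧
    ((∀ r s : V, r ≠ ⊥ → r = tens s r → s = k)
     ↔
     (∀ (X : Type) (a : X → X → V),
        (∀ x, k ≤ a x x) → (∀ x y z, tens (a x y) (a y z) ≤ a x z) →
        (∀ x y, k ≤ a x y → k ≤ a y x → x = y) →
        ∀ (x y : X) (r s : V), r ≠ ⊥ → s ≠ ⊥ →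
          k ≤ ehom r (tens (a x y) s) → k ≤ ehom s (tens (a y x) r) →
          x = y ∧ r = s)) := by
  have mono : ∀ u {v w : V}, v ≤ w → tens u v ≤ tens u w := fun u v w h =>
    (tens_adj u v _).2 (h.trans ((tens_adj u w _).1 le_rfl))
  have le_iff : ∀ u w : V, k ≤ ehom u w ↔ u ≤ w := fun u w => by
    rw [← tens_adj, tens_unit]
  have le_k : ∀ u : V, u ≤ k := fun u => integral ▸ le_top
  have tens_le_left : ∀ u v : V, tens u v ≤ u := fun u v =>
    (mono u (le_k v)).trans (tens_unit u).le
  have tens_le_right : ∀ u v : V, tens u v ≤ v := fun u v =>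
    tens_comm v u ▸ tens_le_left v u
  have cancel_cycle : (∀ r s : V, r ≠ ⊥ → r = tens s r → s = k) →
      ∀ p q r s : V, r ≠ ⊥ → r ≤ tens p s → s ≤ tens q r → k ≤ p ∧ k ≤ q ∧ r = s := by
    intro hc p q r s hr hrs hsr
    have hpq : tens p q = k := hc r _ hr <| le_antisymm
      (by rw [tens_assoc]; exact hrs.trans (mono p hsr)) (tens_le_right _ _)
    exact ⟨hpq ▸ tens_le_left p q, hpq ▸ tens_le_right p q,
      le_antisymm (hrs.trans (tens_le_right _ _)) (hsr.trans (tens_le_right _ _))⟩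
  refine ⟨⟨fun h r s hr hrs => ?_, fun hc x y r s hr _ h₁ h₂ => ?_⟩,
    fun hc X a _ _ hsep x y r s hr _ h₁ h₂ => ?_, fun h r s hr hrs => ?_⟩
  · have hs : s ≤ ehom k s := (tens_adj k s s).1 (tens_le_right k s)
    have hk : k ≤ ehom s k := (le_iff s k).2 (le_k s)
    refine (h k s r r hr hr ((le_iff _ _).2 ?_) ((le_iff _ _).2 ?_)).1.symm
    · rw [tens_comm]
      exact (hrs.trans (tens_comm s r)).le.trans (mono r hs)
    · rw [tens_comm]
      exact (tens_unit r).ge.trans (mono r hk)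
  · obtain ⟨hxy, hyx, hrs⟩ :=
      cancel_cycle hc _ _ r s hr ((le_iff _ _).1 h₁) ((le_iff _ _).1 h₂)
    exact ⟨le_antisymm ((le_iff _ _).1 hxy) ((le_iff _ _).1 hyx), hrs⟩
  · obtain ⟨hxy, hyx, hrs⟩ :=
      cancel_cycle hc _ _ r s hr ((le_iff _ _).1 h₁) ((le_iff _ _).1 h₂)
    exact ⟨hsep x y hxy hyx, hrs⟩
  · by_contra hs
    have hks : ¬ k ≤ s := fun hle => hs (le_antisymm (le_k s) hle)
    have hr' : k ≤ ehom r (tens s r) := (le_iff _ _).2 hrs.le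
    refine absurd (h Bool (fun x y => if x = y then k else s) (fun x => by simp) ?_ ?_
      false true r r hr hr (by simpa using hr') (by simpa using hr')).1 (by simp)
    · intro x y z
      cases x <;> cases y <;> cases z <;>
        simp [tens_le_left, tens_le_right, le_k]
    · intro x y
      cases x <;> cases y <;> simp [hks]
end

section
/- Let V be an integral and cancellative commutative unital quantale and (X,a) a separated V-category. If x,y ∈ X and r,s ∈ V∖{⊥} satisfy a(z,x) ⊗ r = a(z,y) ⊗ s for all z ∈ X, then x = y and r = s. (That is, the comparison σ_X : BX → PX, (x,r) ↦ a(−,x) ⊗ r, is injective, so the formal ball monad is a submonad of the presheaf monad on separated V-categories.) -/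
/-- Over an integral cancellative quantale, the comparison
σ_X : BX → PX, (x,r) ↦ a(−,x) ⊗ r, is injective for separated X. -/
theorem ball_to_presheaf_injective
    {V : Type*} [CompleteLattice V]
    (tens : V → V → V) (k : V) (ehom : V → V → V)
    (tens_comm : ∀ u v, tens u v = tens v u)
    (tens_assoc : ∀ u v w, tens (tens u v) w = tens u (tens v w))
    (tens_unit : ∀ u, tens u k = u)
    (k_ne_bot : k ≠ ⊥)
    (tens_sSup : ∀ (u : V) (S : Set V), tens u (sSup S) = ⨆ s ∈ S, tens u s)
    (tens_adj : ∀ u v w, tens u v ≤ w ↔ v ≤ ehom u w)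
    (integral : k = (⊤ : V))
    (cancellative : ∀ r s : V, r ≠ ⊥ → r = tens s r → s = k)
    {X : Type*} (a : X → X → V)
    (ha_refl : ∀ x, k ≤ a x x)
    (ha_trans : ∀ x y z, tens (a x y) (a y z) ≤ a x z)
    (ha_sep : ∀ x y, k ≤ a x y → k ≤ a y x → x = y) :
    ∀ (x y : X) (r s : V), r ≠ ⊥ → s ≠ ⊥ →
      (∀ z : X, tens (a z x) r = tens (a z y) s) → x = y ∧ r = s := by
  intro x y r s hr _ h
  have tens_le_left (u v : V) : tens u v ≤ u :=
    (tens_adj u v u).2 <| le_top.trans <|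
      (tens_adj u ⊤ u).1 (integral ▸ tens_unit u).le
  have unit_tens (u : V) : tens k u = u := (tens_comm k u).trans (tens_unit u)
  have self_eq (z : X) : a z z = k := le_antisymm (integral ▸ le_top) (ha_refl z)
  have hrs : r = tens (a x y) s := by rw [← h x, self_eq, unit_tens]
  have hsr : s = tens (a y x) r := by rw [h y, self_eq, unit_tens]
  have hk : tens (a x y) (a y x) = k :=
    cancellative r _ hr (by rw [tens_assoc, ← hsr, ← hrs])
  have hxy : k ≤ a x y := hk.ge.trans (tens_le_left _ _)
  have hyx : k ≤ a y x := hk.ge.trans (tens_comm (a x y) (a y x) ▸ tens_le_left _ _)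
  obtain rfl := ha_sep x y hxy hyx
  exact ⟨rfl, by rw [hrs, self_eq, unit_tens]⟩
end

section
/- Let V be an integral commutative unital quantale, (X,a) and (Y,b) V-categories, h : (X,a) → (Y,b) a V-functor, and g : Y × (V∖{⊥}) → X × (V∖{⊥}) a map, written g(y,s) = (y_s, s_y), such that hom(r, a(x, y_s) ⊗ s_y) = hom(r, b(h x, y) ⊗ s) for all x ∈ X, r,s ∈ V∖{⊥}, y ∈ Y (i.e. Bh ⊣ g). Then: (1) hom(r, b(h x, y) ⊗ r) = hom(r, b(h x, h(y_r)) ⊗ r_y) for all y ∈ Y, x ∈ X, r ∈ V∖{⊥}; (2) k_y = b(h(y_k), y) for all y ∈ Y; (3) b(h x, y) = b(h x, h(y_k)) ⊗ b(h(y_k), y) for all y ∈ Y and x ∈ X. -/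
/-- Properties of a right adjoint g = Bh_♯ of Bh, written
g(y,s) = (y_s, s_y). -/
theorem B_embedding_right_adjoint_properties
    {V : Type*} [CompleteLattice V]
    (tens : V → V → V) (k : V) (ehom : V → V → V)
    (tens_comm : ∀ u v, tens u v = tens v u)
    (tens_assoc : ∀ u v w, tens (tens u v) w = tens u (tens v w))
    (tens_unit : ∀ u, tens u k = u)
    (k_ne_bot : k ≠ ⊥)
    (tens_sSup : ∀ (u : V) (S : Set V), tens u (sSup S) = ⨆ s ∈ S, tens u s)
    (tens_adj : ∀ u v w, tens u v ≤ w ↔ v ≤ ehom u w)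
    (integral : k = (⊤ : V))
    {X Y : Type*} (a : X → X → V) (b : Y → Y → V)
    (ha_refl : ∀ x, k ≤ a x x)
    (ha_trans : ∀ x y z, tens (a x y) (a y z) ≤ a x z)
    (hb_refl : ∀ y, k ≤ b y y)
    (hb_trans : ∀ x y z, tens (b x y) (b y z) ≤ b x z)
    (h : X → Y) (hh : ∀ x x', a x x' ≤ b (h x) (h x'))
    (g : Y → V → X × V)
    (hg_ne_bot : ∀ (y : Y) (s : V), s ≠ ⊥ → (g y s).2 ≠ ⊥)
    (hadj : ∀ (x : X) (r s : V) (y : Y), r ≠ ⊥ → s ≠ ⊥ →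
      ehom r (tens (a x (g y s).1) (g y s).2) = ehom r (tens (b (h x) y) s)) :
    (∀ (y : Y) (x : X) (r : V), r ≠ ⊥ →
      ehom r (tens (b (h x) y) r) =
        ehom r (tens (b (h x) (h (g y r).1)) (g y r).2)) ∧
    (∀ y : Y, (g y k).2 = b (h (g y k).1) y) ∧
    (∀ (y : Y) (x : X),
      b (h x) y = tens (b (h x) (h (g y k).1)) (b (h (g y k).1) y)) := by
  have mono_right : ∀ u v w, v ≤ w → tens u v ≤ tens u w := fun u v w hvw =>
    (tens_adj u v _).2 (hvw.trans ((tens_adj u w _).1 le_rfl))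
  have mono_left : ∀ u v w, v ≤ w → tens v u ≤ tens w u := fun u v w hvw => by
    rw [tens_comm v, tens_comm w]
    exact mono_right u v w hvw
  have unit_tens : ∀ u, tens k u = u := fun u => by rw [tens_comm, tens_unit]
  have ehom_unit : ∀ u, ehom k u = u := fun u =>
    eq_of_forall_le_iff fun v => by rw [← tens_adj, unit_tens]
  have adj_eq : ∀ (x : X) (s : V) (y : Y), s ≠ ⊥ →
      tens (a x (g y s).1) (g y s).2 = tens (b (h x) y) s := fun x s y hs => by
    simpa only [ehom_unit] using hadj x k s y k_ne_bot hs
  have radius_eq : ∀ (y : Y) (s : V), s ≠ ⊥ →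
      (g y s).2 = tens (b (h (g y s).1) y) s := fun y s hs => by
    have ha : a (g y s).1 (g y s).1 = k :=
      le_antisymm (integral ▸ le_top) (ha_refl _)
    rw [← adj_eq _ s y hs, ha, unit_tens]
  have key : ∀ (y : Y) (x : X) (r : V), r ≠ ⊥ →
      tens (b (h x) y) r = tens (b (h x) (h (g y r).1)) (g y r).2 := fun y x r hr => by
    apply le_antisymm
    · rw [← adj_eq x r y hr]
      exact mono_left _ _ _ (hh _ _)
    · rw [radius_eq y r hr, ← tens_assoc]
      exact mono_left _ _ _ (hb_trans _ _ _)
  have radius_unit : ∀ y : Y, (g y k).2 = b (h (g y k).1) y := fun y => by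
    simpa only [tens_unit] using radius_eq y k k_ne_bot
  refine ⟨fun y x r hr => congrArg (ehom r) (key y x r hr), radius_unit, fun y x => ?_⟩
  rw [← radius_unit, ← key y x k k_ne_bot, tens_unit]
end

section
/- Let V be an integral and cancellative commutative unital quantale, let (X,a) and (Y,b) be separated V-categories, and let h : (X,a) → (Y,b) be a B-embedding: a V-functor for which there exists g : Y × (V∖{⊥}) → X × (V∖{⊥}), written g(y,s) = (y_s, s_y), with g(h x, r) = (x, r) for all x ∈ X and r ∈ V∖{⊥}, and hom(r, a(x, y_s) ⊗ s_y) = hom(r, b(h x, y) ⊗ s) for all x ∈ X, r,s ∈ V∖{⊥}, y ∈ Y. Then h is fully faithful (b(h x, h x') = a(x,x') for all x,x' ∈ X), and for every y ∈ Y there is exactly one z ∈ X such that b(h x, y) = b(h x, h z) ⊗ b(h z, y) for all x ∈ X. -/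
/-- A B-embedding h between separated V-categories over an
integral cancellative quantale is fully faithful, and every y ∈ Y factors
through a unique z ∈ X: b(hx,y) = b(hx,hz) ⊗ b(hz,y) for all x. -/
theorem B_embedding_fully_faithful_and_factorisation
    {V : Type*} [CompleteLattice V]
    (tens : V → V → V) (k : V) (ehom : V → V → V)
    (tens_comm : ∀ u v, tens u v = tens v u)
    (tens_assoc : ∀ u v w, tens (tens u v) w = tens u (tens v w))
    (tens_unit : ∀ u, tens u k = u)
    (k_ne_bot : k ≠ ⊥)
    (tens_sSup : ∀ (u : V) (S : Set V), tens u (sSup S) = ⨆ s ∈ S, tens u s)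
    (tens_adj : ∀ u v w, tens u v ≤ w ↔ v ≤ ehom u w)
    (integral : k = (⊤ : V))
    (cancellative : ∀ r s : V, r ≠ ⊥ → r = tens s r → s = k)
    {X Y : Type*} (a : X → X → V) (b : Y → Y → V)
    (ha_refl : ∀ x, k ≤ a x x)
    (ha_trans : ∀ x y z, tens (a x y) (a y z) ≤ a x z)
    (ha_sep : ∀ x y, k ≤ a x y → k ≤ a y x → x = y)
    (hb_refl : ∀ y, k ≤ b y y)
    (hb_trans : ∀ x y z, tens (b x y) (b y z) ≤ b x z)
    (hb_sep : ∀ x y, k ≤ b x y → k ≤ b y x → x = y)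
    (h : X → Y) (hh : ∀ x x', a x x' ≤ b (h x) (h x'))
    (g : Y → V → X × V)
    (hg_ne_bot : ∀ (y : Y) (s : V), s ≠ ⊥ → (g y s).2 ≠ ⊥)
    (hg_retract : ∀ (x : X) (r : V), r ≠ ⊥ → g (h x) r = (x, r))
    (hadj : ∀ (x : X) (r s : V) (y : Y), r ≠ ⊥ → s ≠ ⊥ →
      ehom r (tens (a x (g y s).1) (g y s).2) = ehom r (tens (b (h x) y) s)) :
    (∀ x x' : X, b (h x) (h x') = a x x') ∧
    (∀ y : Y, ∃! z : X, ∀ x : X,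
      b (h x) y = tens (b (h x) (h z)) (b (h z) y)) := by
  have ehom_unit : ∀ w, ehom k w = w := fun w => by
    have unit_tens : ∀ u, tens k u = u := fun u => by rw [tens_comm, tens_unit]
    apply le_antisymm
    · simpa [unit_tens] using (tens_adj k (ehom k w) w).2 le_rfl
    · exact (tens_adj k w w).1 (unit_tens w).le
  have tens_le_left : ∀ u v, tens u v ≤ u := fun u v => by
    have key : k ≤ ehom u u := (tens_adj u k u).1 (tens_unit u).le
    exact (tens_adj u v u).2 ((integral ▸ le_top : v ≤ k).trans key)
  have tens_le_right : ∀ u v, tens u v ≤ v := fun u v => tens_comm v u ▸ tens_le_left v u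
  have distance_eq : ∀ x y, tens (a x (g y k).1) (g y k).2 = b (h x) y := fun x y => by
    simpa [ehom_unit, tens_unit] using hadj x k k y k_ne_bot k_ne_bot
  have fully_faithful : ∀ x x', b (h x) (h x') = a x x' := fun x x' => by
    rw [← distance_eq x (h x'), hg_retract x' k k_ne_bot, tens_unit]
  refine ⟨fully_faithful, fun y => ?_⟩
  have radius_eq : b (h (g y k).1) y = (g y k).2 := by
    have self_eq : a (g y k).1 (g y k).1 = k := le_antisymm (integral ▸ le_top) (ha_refl _)
    rw [← distance_eq (g y k).1 y, self_eq, tens_comm, tens_unit]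
  have factor : ∀ x, b (h x) y = tens (b (h x) (h (g y k).1)) (b (h (g y k).1) y) := fun x => by
    rw [radius_eq, fully_faithful, distance_eq]
  refine ⟨(g y k).1, factor, fun z' hz' => ?_⟩
  have radius_ne_bot : b (h (g y k).1) y ≠ ⊥ := radius_eq ▸ hg_ne_bot y k k_ne_bot
  have cycle_eq : tens (a (g y k).1 z') (a z' (g y k).1) = k := by
    apply cancellative _ _ radius_ne_bot
    rw [tens_assoc, ← fully_faithful, ← fully_faithful, ← factor, ← hz']
  exact ha_sep _ _ (cycle_eq.ge.trans (tens_le_right _ _)) (cycle_eq.ge.trans (tens_le_left _ _))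
end

section
/- Characterisation of L-dense points: let V be an integral commutative unital quantale, (X,a) a V-category, and y ∈ X. The following are equivalent: (i) there exists a map φ : X → V such that a(x,x') ≤ φ(x) ⊗ a(y,x') for all x,x' ∈ X (i.e. the point y : E → X is L-dense); (ii) k ≤ a(y,x) for all x ∈ X (i.e. y ≤ x for every x ∈ X). -/
/-- A point y of a V-category (X,a) over an integral quantale is
L-dense iff y ≤ x for every x ∈ X. -/
theorem L_dense_point_characterisation
    {V : Type*} [CompleteLattice V]
    (tens : V → V → V) (k : V) (ehom : V → V → V)
    (tens_comm : ∀ u v, tens u v = tens v u)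
    (tens_assoc : ∀ u v w, tens (tens u v) w = tens u (tens v w))
    (tens_unit : ∀ u, tens u k = u)
    (k_ne_bot : k ≠ ⊥)
    (tens_sSup : ∀ (u : V) (S : Set V), tens u (sSup S) = ⨆ s ∈ S, tens u s)
    (tens_adj : ∀ u v w, tens u v ≤ w ↔ v ≤ ehom u w)
    (integral : k = (⊤ : V))
    {X : Type*} (a : X → X → V)
    (ha_refl : ∀ x, k ≤ a x x)
    (ha_trans : ∀ x y z, tens (a x y) (a y z) ≤ a x z)
    (y : X) :
    (∃ φ : X → V, ∀ x x', a x x' ≤ tens (φ x) (a y x'))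
    ↔
    (∀ x : X, k ≤ a y x) := by
  subst integral
  have tens_le_right (u v : V) : tens u v ≤ v := by
    rw [tens_comm, tens_adj]
    exact le_top.trans ((tens_adj v ⊤ v).1 (tens_unit v).le)
  constructor
  · rintro ⟨φ, hφ⟩ x
    exact (ha_refl x).trans ((hφ x x).trans (tens_le_right _ _))
  · intro hy
    refine ⟨fun _ => ⊤, fun x x' => ?_⟩
    rw [top_le_iff.1 (hy x'), tens_unit]
    exact le_top
end
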